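/- For n = 4, Q_3 = P_3 :_S Δ, the colon of P_3 by the single element Δ = det X; that is, Q_3 = {g ∈ S : gΔ ∈ P_3}. -/

import Mathlib

open Matrix

/-- The generic `n × n` matrix whose entries are the variables `x i j` of the
polynomial ring `K[X]`. -/
noncomputable def genMat (K : Type*) [Field K] (n : ℕ) :
    Matrix (Fin n) (Fin n) (MvPolynomial (Fin n × Fin n) K) :=
  fun i j => MvPolynomial.X (i, j)

/-- `P_t`: the ideal generated by the principal `t`-minors of the generic matrix,
i.e. the determinants of the submatrices whose rows and columns are both indexed by
a subset `s` of cardinality `t`. -/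
noncomputable def prinMinorIdeal (K : Type*) [Field K] (n t : ℕ) :
    Ideal (MvPolynomial (Fin n × Fin n) K) :=
  Ideal.span {p | ∃ s : Finset (Fin n), s.card = t ∧
    p = ((genMat K n).submatrix (fun i : {x // x ∈ s} => (i : Fin n))
        (fun j : {x // x ∈ s} => (j : Fin n))).det}

/-- `Q_{n-1}`: the contraction to `S = K[X]` of the extension of `P_{n-1}` to the
localization `S_Δ = S[1/Δ]`, where `Δ = det X`. -/
noncomputable def Qideal (K : Type*) [Field K] (n : ℕ) :
    Ideal (MvPolynomial (Fin n × Fin n) K) :=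
  Ideal.comap (algebraMap (MvPolynomial (Fin n × Fin n) K)
      (Localization.Away (genMat K n).det))
    (Ideal.map (algebraMap (MvPolynomial (Fin n × Fin n) K)
      (Localization.Away (genMat K n).det)) (prinMinorIdeal K n (n - 1)))

section Depth

variable {R : Type*} [CommRing R]

/-- `x` is a nonzerodivisor modulo the ideal `I`. -/
def RegularMod (I : Ideal R) (x : R) : Prop := ∀ r, x * r ∈ I → r ∈ I

/-- The list is a weakly regular sequence modulo `I`. -/
def RegularSeqMod : Ideal R → List R → Prop
  | _, [] => True
  | I, f :: fs => RegularMod I f ∧ RegularSeqMod (I ⊔ Ideal.span {f}) fs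

/-- `p` is an associated prime of `R ⧸ I`, in terms of elements of `R`. -/
def IsAssocMod (I p : Ideal R) : Prop := p.IsPrime ∧ ∃ z, ∀ r, r ∈ p ↔ r * z ∈ I

theorem isAssocMod_iff [IsNoetherianRing R] {I p : Ideal R} :
    IsAssocMod I p ↔ p ∈ associatedPrimes R (R ⧸ I) := by
  have key : ∀ r z : R, r • (Ideal.Quotient.mk I z) = 0 ↔ r * z ∈ I := fun r z => by
    rw [← Ideal.Quotient.eq_zero_iff_mem, map_mul]; rfl
  rw [AssociatedPrimes.mem_iff, isAssociatedPrime_iff, IsAssocMod]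
  refine and_congr_right fun _ => ⟨?_, ?_⟩
  · rintro ⟨z, hz⟩
    refine ⟨Ideal.Quotient.mk I z, Ideal.ext fun r => ?_⟩
    rw [hz, Submodule.mem_colon_singleton, Submodule.mem_bot, key]
  · rintro ⟨z, hz⟩
    obtain ⟨z, rfl⟩ := Ideal.Quotient.mk_surjective z
    refine ⟨z, fun r => ?_⟩
    rw [hz, Submodule.mem_colon_singleton, Submodule.mem_bot, key]

theorem finite_setOf_isAssocMod [IsNoetherianRing R] (I : Ideal R) :
    {p | IsAssocMod I p}.Finite := by
  have := associatedPrimes.finite R (R ⧸ I)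
  exact this.subset fun p hp => isAssocMod_iff.1 hp

theorem exists_isAssocMod_of_notMem [IsNoetherianRing R] {I : Ideal R} {z : R} (hz : z ∉ I) :
    ∃ p, IsAssocMod I p ∧ ∀ r, r * z ∈ I → r ∈ p := by
  obtain ⟨p, hp, hle⟩ := exists_le_isAssociatedPrime_of_isNoetherianRing R
    (Ideal.Quotient.mk I z) (by rwa [Ne, Ideal.Quotient.eq_zero_iff_mem])
  refine ⟨p, isAssocMod_iff.2 hp, fun r hr => hle ?_⟩
  rw [Submodule.mem_colon_singleton, Submodule.mem_bot]
  rw [← Ideal.Quotient.eq_zero_iff_mem, map_mul] at hr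
  exact hr

theorem regularMod_of_forall_notMem [IsNoetherianRing R] {I : Ideal R} {x : R}
    (h : ∀ p, IsAssocMod I p → x ∉ p) : RegularMod I x := by
  intro r hr
  by_contra hrI
  obtain ⟨p, hp, hle⟩ := exists_isAssocMod_of_notMem hrI
  exact h p hp (hle x hr)

theorem RegularMod.swap {I : Ideal R} {x y : R} (hx : RegularMod I x)
    (hy : RegularMod (I ⊔ Ideal.span {x}) y) : RegularMod (I ⊔ Ideal.span {y}) x := by
  intro r hr
  obtain ⟨i, hi, w, hw⟩ := Submodule.mem_sup.1 hr
  obtain ⟨hw, e⟩ := hw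
  obtain ⟨w, rfl⟩ := Ideal.mem_span_singleton'.1 hw
  have h1 : w ∈ I ⊔ Ideal.span {x} := by
    apply hy
    have : y * w = -i + r * x := by linear_combination e
    rw [this]
    exact Submodule.add_mem_sup (I.neg_mem hi) (Ideal.mem_span_singleton'.2 ⟨r, rfl⟩)
  obtain ⟨j, hj, v, hv, e'⟩ := Submodule.mem_sup.1 h1
  obtain ⟨v, rfl⟩ := Ideal.mem_span_singleton'.1 hv
  have h2 : r - v * y ∈ I := by
    apply hx
    have : x * (r - v * y) = i + y * j := by linear_combination -e - y * e'
    rw [this]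
    exact I.add_mem hi (I.mul_mem_left _ hj)
  have : r = (r - v * y) + v * y := by ring
  rw [this]
  exact Submodule.add_mem_sup h2 (Ideal.mem_span_singleton'.2 ⟨v, rfl⟩)

/-- Prime avoidance for cosets, over an infinite coefficient field. -/
theorem exists_sup_span_singleton_eq (K : Type*) [Field K] [Infinite K] [Algebra K R]
    {p : Ideal R} {l : R} (T : Set (Ideal R)) (hT : T.Finite)
    (h : ∀ q ∈ T, ¬ p ⊔ Ideal.span {l} ≤ q) :
    ∃ w, p ⊔ Ideal.span {w} = p ⊔ Ideal.span {l} ∧ ∀ q ∈ T, w ∉ q := by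
  classical
  let φ : (p.restrictScalars K) × K →ₗ[K] R :=
    LinearMap.coprod (p.restrictScalars K).subtype (LinearMap.toSpanSingleton K R l)
  have hφ : ∀ q a, φ (q, a) = (q : R) + a • l := fun q a => by simp [φ]
  let s : Finset (Subspace K ((p.restrictScalars K) × K)) :=
    insert (LinearMap.ker (LinearMap.snd K (p.restrictScalars K) K))
      (hT.toFinset.image fun q => (q.restrictScalars K).comap φ)
  have hs : ⊤ ∉ s := by
    intro hs
    rcases Finset.mem_insert.1 hs with hs | hs
    · have h1 : ((0, 1) : (p.restrictScalars K) × K) ∈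
          LinearMap.ker (LinearMap.snd K (p.restrictScalars K) K) := hs ▸ Submodule.mem_top
      simp at h1
    · obtain ⟨q, hq, hqt⟩ := Finset.mem_image.1 hs
      have hall : ∀ v, φ v ∈ q := fun v => by
        have : v ∈ (q.restrictScalars K).comap φ := hqt ▸ Submodule.mem_top
        simpa using this
      refine h q (by simpa using hq) (sup_le (fun r hr => ?_) ?_)
      · simpa [hφ] using hall (⟨r, hr⟩, 0)
      · rw [Ideal.span_singleton_le_iff_mem]
        simpa [hφ] using hall (0, 1)
  obtain ⟨⟨q, a⟩, hv⟩ := (Set.ne_univ_iff_exists_notMem _).1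
    (Subspace.biUnion_ne_univ_of_top_notMem hs)
  simp only [Set.mem_iUnion, not_exists] at hv
  have ha : a ≠ 0 := by
    intro ha
    exact hv _ (Finset.mem_insert_self _ _) (by simp [ha])
  refine ⟨φ (q, a), ?_, fun q' hq' hmem => ?_⟩
  · have hqp : (q : R) ∈ p := q.2
    apply le_antisymm
    · refine sup_le le_sup_left ?_
      rw [Ideal.span_singleton_le_iff_mem, hφ]
      refine Submodule.add_mem_sup hqp ?_
      rw [Algebra.smul_def]
      exact Ideal.mul_mem_left _ _ (Ideal.mem_span_singleton_self l)
    · refine sup_le le_sup_left ?_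
      rw [Ideal.span_singleton_le_iff_mem]
      have hl : l = algebraMap K R a⁻¹ * -(q : R) + algebraMap K R a⁻¹ * φ (q, a) := by
        rw [hφ, Algebra.smul_def, mul_add, ← mul_assoc, ← map_mul, inv_mul_cancel₀ ha]
        simp
      nth_rewrite 1 [hl]
      exact Submodule.add_mem_sup (p.mul_mem_left _ (p.neg_mem hqp))
        (Ideal.mul_mem_left _ _ (Ideal.mem_span_singleton_self _))
  · exact hv _ (Finset.mem_insert_of_mem
      (Finset.mem_image_of_mem _ (hT.mem_toFinset.2 hq'))) (by simpa using hmem)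

variable [IsLocalRing R]

open IsLocalRing

/-- There is a regular sequence of length `n` modulo `I` in the maximal ideal after which the
maximal ideal becomes associated, i.e. `R ⧸ I` has depth `n`. -/
def HasDepth : ℕ → Ideal R → Prop
  | 0, I => ∃ z, z ∉ I ∧ ∀ r ∈ maximalIdeal R, r * z ∈ I
  | n + 1, I => ∃ x ∈ maximalIdeal R, RegularMod I x ∧ HasDepth n (I ⊔ Ideal.span {x})

/-- An inductive form of the bound `dim (R ⧸ J) ≤ k`. -/
def DimLE : ℕ → Ideal R → Prop
  | 0, J => ∀ p : Ideal R, p.IsPrime → J ≤ p → maximalIdeal R ≤ p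
  | k + 1, J => ∀ p : Ideal R, p.IsPrime → J ≤ p →
      ∃ l ∈ maximalIdeal R, DimLE k (p ⊔ Ideal.span {l})

theorem DimLE.mono {k : ℕ} {J J' : Ideal R} (h : DimLE k J) (hJ : J ≤ J') : DimLE k J' := by
  cases k with
  | zero => exact fun p hp hle => h p hp (hJ.trans hle)
  | succ k => exact fun p hp hle => h p hp (hJ.trans hle)

theorem DimLE.of_sup {k : ℕ} {J : Ideal R} {l : R} (hl : l ∈ maximalIdeal R)
    (h : DimLE k (J ⊔ Ideal.span {l})) : DimLE (k + 1) J :=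
  fun _ _ hle => ⟨l, hl, h.mono (sup_le_sup_right hle _)⟩

theorem DimLE.of_forall_isPrime {k : ℕ} {J : Ideal R}
    (h : ∀ p : Ideal R, p.IsPrime → J ≤ p → DimLE (k + 1) p) : DimLE (k + 1) J :=
  fun p hp hle => h p hp hle p hp le_rfl

theorem DimLE.of_list {J : Ideal R} (L : List R) (hL : ∀ l ∈ L, l ∈ maximalIdeal R)
    (h : ∀ q : Ideal R, q.IsPrime → J ≤ q → (∀ l ∈ L, l ∈ q) → maximalIdeal R ≤ q) :
    DimLE L.length J := by
  induction L generalizing J with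
  | nil => exact fun p hp hle => h p hp hle (by simp)
  | cons l L ih =>
    refine DimLE.of_sup (hL l (by simp)) (ih (fun l' hl' => hL l' (by simp [hl'])) ?_)
    intro q hq hle hLq
    refine h q hq (le_sup_left.trans hle) fun l' hl' => ?_
    rcases List.mem_cons.1 hl' with rfl | hl'
    · exact hle (le_sup_right (a := J) (Ideal.mem_span_singleton_self l'))
    · exact hLq l' hl'

theorem HasDepth.zero_of_regularMod {I : Ideal R} {a b : R}
    (hb : b ∈ maximalIdeal R) (hra : RegularMod I a) (hrb : RegularMod I b)
    (h : HasDepth 0 (I ⊔ Ideal.span {a})) : HasDepth 0 (I ⊔ Ideal.span {b}) := by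
  obtain ⟨z, hz, hmz⟩ := h
  obtain ⟨i, hi, w, hw, e⟩ := Submodule.mem_sup.1 (hmz b hb)
  obtain ⟨w, rfl⟩ := Ideal.mem_span_singleton'.1 hw
  refine ⟨w, fun hwb => hz ?_, fun r hr => ?_⟩
  · obtain ⟨i', hi', v, hv, e'⟩ := Submodule.mem_sup.1 hwb
    obtain ⟨v, rfl⟩ := Ideal.mem_span_singleton'.1 hv
    have h1 : z - v * a ∈ I := by
      apply hrb
      have : b * (z - v * a) = i + a * i' := by linear_combination -e - a * e'
      rw [this]
      exact I.add_mem hi (I.mul_mem_left _ hi')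
    have : z = (z - v * a) + v * a := by ring
    rw [this]
    exact Submodule.add_mem_sup h1 (Ideal.mem_span_singleton'.2 ⟨v, rfl⟩)
  · obtain ⟨i', hi', v, hv, e'⟩ := Submodule.mem_sup.1 (hmz r hr)
    obtain ⟨v, rfl⟩ := Ideal.mem_span_singleton'.1 hv
    have h1 : r * w - v * b ∈ I := by
      apply hra
      have : a * (r * w - v * b) = b * i' - r * i := by linear_combination r * e - b * e'
      rw [this]
      exact I.sub_mem (I.mul_mem_left _ hi') (I.mul_mem_left _ hi)
    have : r * w = (r * w - v * b) + v * b := by ring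
    rw [this]
    exact Submodule.add_mem_sup h1 (Ideal.mem_span_singleton'.2 ⟨v, rfl⟩)

theorem IsAssocMod.hasDepth_zero {I : Ideal R} (h : IsAssocMod I (maximalIdeal R)) :
    HasDepth 0 I := by
  obtain ⟨hp, z, hz⟩ := h
  refine ⟨z, fun hzI => hp.ne_top ?_, fun r hr => (hz r).1 hr⟩
  rw [Ideal.eq_top_iff_one, hz, one_mul]
  exact hzI

theorem not_hasDepth_zero {I : Ideal R} {x : R} (hx : x ∈ maximalIdeal R)
    (hr : RegularMod I x) : ¬ HasDepth 0 I := by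
  rintro ⟨z, hz, h⟩
  exact hz (hr z (h x hx))

/-- Prime avoidance: finitely many ideals of positive depth admit a common regular element. -/
theorem exists_regularMod_of_not_hasDepth_zero [IsNoetherianRing R] {I J : Ideal R}
    (hI : ¬ HasDepth 0 I) (hJ : ¬ HasDepth 0 J) :
    ∃ z ∈ maximalIdeal R, RegularMod I z ∧ RegularMod J z := by
  classical
  set T : Finset (Ideal R) :=
    (finite_setOf_isAssocMod I).toFinset ∪ (finite_setOf_isAssocMod J).toFinset with hT
  have hTp : ∀ p ∈ T, IsAssocMod I p ∨ IsAssocMod J p := by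
    intro p hp
    simpa [hT] using hp
  have hne : ¬ ((maximalIdeal R : Set R) ⊆ ⋃ p ∈ (T : Set (Ideal R)), (p : Set R)) := by
    rw [Ideal.subset_union_prime (f := fun p : Ideal R => p) ⊥ ⊥
      (fun p hp _ _ => (hTp p hp).elim (fun h => h.1) (fun h => h.1))]
    rintro ⟨p, hp, hle⟩
    have hpm : ∀ I, IsAssocMod I p → HasDepth 0 I := by
      intro I h
      have : p = maximalIdeal R :=
        le_antisymm (IsLocalRing.le_maximalIdeal h.1.ne_top) hle
      exact IsAssocMod.hasDepth_zero (this ▸ h)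
    exact (hTp p hp).elim (fun h => hI (hpm I h)) (fun h => hJ (hpm J h))
  obtain ⟨z, hz, hzT⟩ := Set.not_subset.1 hne
  simp only [Set.mem_iUnion, not_exists] at hzT
  exact ⟨z, hz, regularMod_of_forall_notMem fun p hp => hzT p (by simp [hT, hp]),
    regularMod_of_forall_notMem fun p hp => hzT p (by simp [hT, hp])⟩

theorem HasDepth.sup_span_singleton [IsNoetherianRing R] {n : ℕ} {I : Ideal R} {y : R}
    (h : HasDepth (n + 1) I) (hy : y ∈ maximalIdeal R) (hry : RegularMod I y) :
    HasDepth n (I ⊔ Ideal.span {y}) := by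
  induction n generalizing I y with
  | zero =>
    obtain ⟨x, hx, hrx, h⟩ := h
    exact HasDepth.zero_of_regularMod hy hrx hry h
  | succ n ih =>
    obtain ⟨x, hx, hrx, h⟩ := h
    have hx0 : ¬ HasDepth 0 (I ⊔ Ideal.span {x}) := by
      obtain ⟨x', hx', hrx', -⟩ := h
      exact not_hasDepth_zero hx' hrx'
    have hy0 : ¬ HasDepth 0 (I ⊔ Ideal.span {y}) :=
      fun h' => hx0 (HasDepth.zero_of_regularMod hx hry hrx h')
    obtain ⟨z, hz, hzx, hzy⟩ := exists_regularMod_of_not_hasDepth_zero hx0 hy0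
    have h1 : HasDepth (n + 1) (I ⊔ Ideal.span {z}) := by
      refine ⟨x, hx, hrx.swap hzx, ?_⟩
      rw [sup_right_comm]
      exact ih h hz hzx
    refine ⟨z, hz, hzy, ?_⟩
    rw [sup_right_comm]
    exact ih h1 hy (hry.swap hzy)

theorem IsAssocMod.exists_sup_span_singleton_le [IsNoetherianRing R] {I p : Ideal R} {y : R}
    (hp : IsAssocMod I p) (hy : y ∈ maximalIdeal R) (hry : RegularMod I y) :
    ∃ p', IsAssocMod (I ⊔ Ideal.span {y}) p' ∧ p ⊔ Ideal.span {y} ≤ p' := by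
  obtain ⟨hprime, z₀, hz₀⟩ := hp
  let N : Ideal R :=
    { carrier := {z | ∀ q ∈ p, q * z ∈ I}
      add_mem' := fun {a b} ha hb q hq => by
        rw [mul_add]; exact I.add_mem (ha q hq) (hb q hq)
      zero_mem' := fun q _ => by simp
      smul_mem' := fun c z hz q hq => by
        rw [smul_eq_mul, mul_left_comm]; exact I.mul_mem_left _ (hz q hq) }
  have hN : ∀ z, z ∈ N ↔ ∀ q ∈ p, q * z ∈ I := fun z => Iff.rfl
  have hz₀N : z₀ ∈ N := fun q hq => (hz₀ q).1 hq
  have hz₀I : z₀ ∉ I := fun h => hprime.ne_top <| by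
    rw [Ideal.eq_top_iff_one, hz₀, one_mul]
    exact h
  have hne : ¬ N ≤ I ⊔ Ideal.span {y} := by
    intro hle
    refine hz₀I (Submodule.le_of_le_smul_of_le_jacobson_bot (I := Ideal.span {y}) (N := I)
      (N' := N) (IsNoetherian.noetherian _) ?_ ?_ hz₀N)
    · rw [IsLocalRing.jacobson_eq_maximalIdeal ⊥ bot_ne_top, Ideal.span_singleton_le_iff_mem]
      exact hy
    · intro z hz
      obtain ⟨i, hi, w, hw, e⟩ := Submodule.mem_sup.1 (hle hz)
      obtain ⟨w, rfl⟩ := Ideal.mem_span_singleton'.1 hw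
      rw [← e]
      refine Submodule.add_mem_sup hi ?_
      rw [mul_comm]
      refine Submodule.smul_mem_smul (Ideal.mem_span_singleton_self y) fun q hq => ?_
      apply hry
      have : y * (q * w) = q * z - q * i := by linear_combination q * e
      rw [this]
      exact I.sub_mem (hz q hq) (I.mul_mem_left _ hi)
  obtain ⟨z, hzN, hz⟩ := Set.not_subset.1 hne
  obtain ⟨p', hp', hle⟩ := exists_isAssocMod_of_notMem hz
  refine ⟨p', hp', sup_le (fun q hq => hle q (le_sup_left (b := Ideal.span {y}) (hzN q hq))) ?_⟩
  rw [Ideal.span_singleton_le_iff_mem]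
  exact hle y (le_sup_right (a := I) (Ideal.mul_mem_right _ _ (Ideal.mem_span_singleton_self y)))

theorem IsAssocMod.le_of_dimLE (K : Type*) [Field K] [Infinite K] [Algebra K R]
    [IsNoetherianRing R] {k n : ℕ} {I p : Ideal R} (hI : HasDepth n I) (hp : IsAssocMod I p)
    (hk : DimLE k p) : n ≤ k := by
  induction k generalizing n I p with
  | zero =>
    cases n with
    | zero => exact le_rfl
    | succ n =>
      obtain ⟨x, hx, hrx, -⟩ := hI
      obtain ⟨hprime, z, hz⟩ := hp
      have hxz := (hz x).1 (hk p hprime le_rfl hx)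
      exact absurd ((Ideal.eq_top_iff_one p).2 ((hz 1).2 (by simpa using hrx z hxz)))
        hprime.ne_top
  | succ k ih =>
    cases n with
    | zero => exact Nat.zero_le _
    | succ n =>
      obtain ⟨l, hl, hkl⟩ := hk p hp.1 le_rfl
      by_cases hex : ∃ p', IsAssocMod I p' ∧ p ⊔ Ideal.span {l} ≤ p'
      · obtain ⟨p', hp', hle⟩ := hex
        exact (ih hI hp' (hkl.mono hle)).trans (Nat.le_succ k)
      · push Not at hex
        obtain ⟨w, hw, hwT⟩ := exists_sup_span_singleton_eq K _ (finite_setOf_isAssocMod I) hex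
        have hrw : RegularMod I w := regularMod_of_forall_notMem hwT
        have hwm : w ∈ maximalIdeal R := by
          have : p ⊔ Ideal.span {l} ≤ maximalIdeal R :=
            sup_le (IsLocalRing.le_maximalIdeal hp.1.ne_top)
              ((Ideal.span_singleton_le_iff_mem _).2 hl)
          exact this (hw ▸ le_sup_right (a := p) (Ideal.mem_span_singleton_self w))
        obtain ⟨p', hp', hle⟩ := hp.exists_sup_span_singleton_le hwm hrw
        rw [hw] at hle
        exact Nat.succ_le_succ (ih (hI.sup_span_singleton hwm hrw) hp' (hkl.mono hle))

theorem HasDepth.regularSeqMod (K : Type*) [Field K] [Infinite K] [Algebra K R]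
    [IsNoetherianRing R] (fs : List R) {m : ℕ} {I : Ideal R} (hI : HasDepth (m + fs.length) I)
    (hfs : ∀ f ∈ fs, f ∈ maximalIdeal R) (hm : DimLE m (I ⊔ Ideal.span {f | f ∈ fs})) :
    RegularSeqMod I fs := by
  have hdim : ∀ (gs : List R) (J : Ideal R), (∀ f ∈ gs, f ∈ maximalIdeal R) →
      DimLE m (J ⊔ Ideal.span {f | f ∈ gs}) → DimLE (m + gs.length) J := by
    intro gs
    induction gs with
    | nil => intro J _ h; simpa using h
    | cons g gs ih =>
      intro J hgs h
      refine DimLE.of_sup (hgs g (by simp)) (ih _ (fun f hf => hgs f (by simp [hf])) ?_)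
      refine h.mono (sup_le (le_sup_left.trans le_sup_left) (Ideal.span_le.2 fun f hf => ?_))
      rcases List.mem_cons.1 hf with rfl | hf
      · exact le_sup_left (a := J ⊔ Ideal.span {f})
          (le_sup_right (a := J) (Ideal.mem_span_singleton_self f))
      · exact le_sup_right (a := J ⊔ Ideal.span {g}) (Ideal.subset_span hf)
  induction fs generalizing I with
  | nil => trivial
  | cons f fs ih =>
    have hf := hfs f (by simp)
    have hm' : DimLE m (I ⊔ Ideal.span {f} ⊔ Ideal.span {g | g ∈ fs}) := by
      refine hm.mono (sup_le (le_sup_left.trans le_sup_left) (Ideal.span_le.2 fun g hg => ?_))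
      rcases List.mem_cons.1 hg with rfl | hg
      · exact le_sup_left (a := I ⊔ Ideal.span {g})
          (le_sup_right (a := I) (Ideal.mem_span_singleton_self g))
      · exact le_sup_right (a := I ⊔ Ideal.span {f}) (Ideal.subset_span hg)
    have hfs' : ∀ g ∈ fs, g ∈ maximalIdeal R := fun g hg => hfs g (by simp [hg])
    have hreg : RegularMod I f := by
      refine regularMod_of_forall_notMem fun p hp hfp => ?_
      have h1 := hdim fs _ hfs' hm'
      have h2 : I ≤ p := by
        obtain ⟨_, z, hz⟩ := hp
        exact fun r hr => (hz r).2 (I.mul_mem_right _ hr)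
      have h3 := IsAssocMod.le_of_dimLE K hI hp
        (h1.mono (sup_le h2 ((Ideal.span_singleton_le_iff_mem _).2 hfp)))
      simp at h3
    exact ⟨hreg, ih (hI.sup_span_singleton hf hreg) hfs' hm'⟩

end Depth

section Localization

theorem RegularMod.map_algebraMap {S R : Type*} [CommRing S] [CommRing R] [Algebra S R]
    (M : Submonoid S) [IsLocalization M R] {I : Ideal S} {x : S} (h : RegularMod I x) :
    RegularMod (I.map (algebraMap S R)) (algebraMap S R x) := by
  intro r hr
  obtain ⟨⟨s, u⟩, hs⟩ := IsLocalization.surj M r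
  have h1 : algebraMap S R (x * s) ∈ I.map (algebraMap S R) := by
    rw [map_mul, ← hs, ← mul_assoc]
    exact Ideal.mul_mem_right _ _ hr
  rw [IsLocalization.algebraMap_mem_map_algebraMap_iff M] at h1
  obtain ⟨v, hv, hvx⟩ := h1
  have h2 : algebraMap S R s ∈ I.map (algebraMap S R) := by
    rw [IsLocalization.algebraMap_mem_map_algebraMap_iff M]
    exact ⟨v, hv, h _ (by rwa [mul_left_comm] at hvx)⟩
  rw [← hs] at h2
  exact (Ideal.mul_unit_mem_iff_mem _ (IsLocalization.map_units R u)).1 h2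

theorem exists_notMem_mul_mem_of_regularMod {S R : Type*} [CommRing S] [CommRing R] [Algebra S R]
    (M : Submonoid S) [IsLocalization M R] {I : Ideal S} {x h : S}
    (hx : RegularMod (I.map (algebraMap S R)) (algebraMap S R x)) (hh : x * h ∈ I) :
    ∃ u ∈ M, u * h ∈ I := by
  rw [← IsLocalization.algebraMap_mem_map_algebraMap_iff M R]
  refine hx _ ?_
  rw [← map_mul]
  exact Ideal.mem_map_of_mem _ hh

variable {σ K : Type*} [Field K]

theorem regularMod_span_X_image {A : Set σ} {a : σ} (ha : a ∉ A) :
    RegularMod (Ideal.span ((MvPolynomial.X : σ → MvPolynomial σ K) '' A))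
      (MvPolynomial.X a) := by
  classical
  intro r hr
  rw [MvPolynomial.mem_ideal_span_X_image] at hr ⊢
  intro m hm
  obtain ⟨i, hi, h⟩ := hr (Finsupp.single a 1 + m) (by
    rw [MvPolynomial.mem_support_iff, MvPolynomial.coeff_X_mul]
    exact MvPolynomial.mem_support_iff.1 hm)
  refine ⟨i, hi, ?_⟩
  have hia : a ≠ i := fun h => ha (h ▸ hi)
  simpa [Finsupp.single_apply, hia] using h

/-- The ideal of the origin in affine space. -/
noncomputable abbrev originIdeal (σ K : Type*) [Field K] : Ideal (MvPolynomial σ K) :=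
  RingHom.ker (MvPolynomial.constantCoeff : MvPolynomial σ K →+* K)

instance : (originIdeal σ K).IsPrime := RingHom.ker_isPrime _

theorem originIdeal_eq_span :
    originIdeal σ K = Ideal.span ((MvPolynomial.X : σ → MvPolynomial σ K) '' Set.univ) := by
  ext p
  rw [RingHom.mem_ker, MvPolynomial.mem_ideal_span_X_image, MvPolynomial.constantCoeff_eq]
  constructor
  · intro h m hm
    have : m ≠ 0 := by
      rintro rfl
      exact MvPolynomial.mem_support_iff.1 hm h
    obtain ⟨i, hi⟩ := Finsupp.ne_iff.1 this
    exact ⟨i, trivial, hi⟩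
  · intro h
    by_contra hne
    obtain ⟨i, -, hi⟩ := h 0 (MvPolynomial.mem_support_iff.2 hne)
    exact hi rfl

/-- The local ring of affine space at the origin. -/
abbrev OriginRing (σ K : Type*) [Field K] : Type _ :=
  Localization.AtPrime (originIdeal σ K)

theorem maximalIdeal_originRing :
    IsLocalRing.maximalIdeal (OriginRing σ K) =
      Ideal.span ((fun i => algebraMap (MvPolynomial σ K) (OriginRing σ K) (MvPolynomial.X i)) ''
        Set.univ) := by
  have h := congrArg (Ideal.map (algebraMap (MvPolynomial σ K) (OriginRing σ K)))
    (originIdeal_eq_span (σ := σ) (K := K))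
  rw [Localization.AtPrime.map_eq_maximalIdeal, Ideal.map_span, ← Set.image_comp] at h
  exact h

theorem algebraMap_mem_maximalIdeal {p : MvPolynomial σ K} (hp : p ∈ originIdeal σ K) :
    algebraMap _ (OriginRing σ K) p ∈ IsLocalRing.maximalIdeal (OriginRing σ K) := by
  rw [← Localization.AtPrime.map_eq_maximalIdeal]
  exact Ideal.mem_map_of_mem _ hp

theorem hasDepth_originRing [Fintype σ] :
    HasDepth (Fintype.card σ) (⊥ : Ideal (OriginRing σ K)) := by
  classical
  have key : ∀ t : Finset σ, HasDepth t.card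
      ((Ideal.span ((MvPolynomial.X : σ → MvPolynomial σ K) '' (t : Set σ)ᶜ)).map
        (algebraMap _ (OriginRing σ K))) := by
    intro t
    induction t using Finset.induction_on with
    | empty =>
      rw [Finset.coe_empty, Set.compl_empty, ← originIdeal_eq_span]
      have h := Localization.AtPrime.map_eq_maximalIdeal (I := originIdeal σ K)
      rw [h]
      exact ⟨1, (Ideal.ne_top_iff_one _).1 (IsLocalRing.maximalIdeal.isMaximal _).ne_top,
        fun r hr => by simpa using hr⟩
    | insert a t ha ih =>
      rw [Finset.card_insert_of_notMem ha]
      refine ⟨algebraMap _ _ (MvPolynomial.X a), algebraMap_mem_maximalIdeal (by simp),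
        RegularMod.map_algebraMap (originIdeal σ K).primeCompl
          (regularMod_span_X_image (by simp)), ?_⟩
      convert ih using 1
      rw [← Set.image_singleton, ← Ideal.map_span, ← Ideal.map_sup, ← Ideal.span_union,
        ← Set.image_singleton, ← Set.image_union]
      congr 3
      ext i
      by_cases hi : i = a
      · simp [hi, ha]
      · simp [hi]
  have := key Finset.univ
  simpa using this

end Localization

section DeterminantalCases

variable {D : Type*} [CommRing D]

/-- A quartic form `c` such that `c * det M` lies in the ideal of principal `3`-minors. -/
def auxQuartic (M : Matrix (Fin 4) (Fin 4) D) : D :=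
  -(M 0 2 * M 1 0 * M 2 1 * M 3 3) + M 0 2 * M 1 1 * M 2 0 * M 3 3
    - M 0 3 * M 1 1 * M 2 0 * M 3 2 + M 0 0 * M 1 3 * M 2 1 * M 3 2
    - M 0 0 * M 1 3 * M 2 2 * M 3 1 + M 0 3 * M 1 0 * M 2 2 * M 3 1

theorem adjugate_fin_four (M : Matrix (Fin 4) (Fin 4) D) (i j : Fin 4) :
    M.adjugate i j = (-1) ^ (j + i : ℕ) *
      (M (j.succAbove 0) (i.succAbove 0) * M (j.succAbove 1) (i.succAbove 1)
          * M (j.succAbove 2) (i.succAbove 2)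
        - M (j.succAbove 0) (i.succAbove 0) * M (j.succAbove 1) (i.succAbove 2)
          * M (j.succAbove 2) (i.succAbove 1)
        - M (j.succAbove 0) (i.succAbove 1) * M (j.succAbove 1) (i.succAbove 0)
          * M (j.succAbove 2) (i.succAbove 2)
        + M (j.succAbove 0) (i.succAbove 1) * M (j.succAbove 1) (i.succAbove 2)
          * M (j.succAbove 2) (i.succAbove 0)
        + M (j.succAbove 0) (i.succAbove 2) * M (j.succAbove 1) (i.succAbove 0)
          * M (j.succAbove 2) (i.succAbove 1)
        - M (j.succAbove 0) (i.succAbove 2) * M (j.succAbove 1) (i.succAbove 1)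
          * M (j.succAbove 2) (i.succAbove 0)) := by
  rw [Matrix.adjugate_fin_succ_eq_det_submatrix, Matrix.det_fin_three]
  rfl

theorem det_eq_row_zero (M : Matrix (Fin 4) (Fin 4) D) :
    M.det = M 0 0 * M.adjugate 0 0 + M 0 1 * M.adjugate 1 0 + M 0 2 * M.adjugate 2 0
      + M 0 3 * M.adjugate 3 0 := by
  have h := congrFun (congrFun (Matrix.mul_adjugate M) 0) 0
  simpa [Matrix.mul_apply, Fin.sum_univ_four] using h.symm

theorem succAbove_fin_four :
    (Fin.succAbove (0 : Fin 4) 0 = 1 ∧ Fin.succAbove (0 : Fin 4) 1 = 2 ∧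
      Fin.succAbove (0 : Fin 4) 2 = 3) ∧
    (Fin.succAbove (1 : Fin 4) 0 = 0 ∧ Fin.succAbove (1 : Fin 4) 1 = 2 ∧
      Fin.succAbove (1 : Fin 4) 2 = 3) ∧
    (Fin.succAbove (2 : Fin 4) 0 = 0 ∧ Fin.succAbove (2 : Fin 4) 1 = 1 ∧
      Fin.succAbove (2 : Fin 4) 2 = 3) ∧
    (Fin.succAbove (3 : Fin 4) 0 = 0 ∧ Fin.succAbove (3 : Fin 4) 1 = 1 ∧
      Fin.succAbove (3 : Fin 4) 2 = 2) ∧ ((3 : Fin 4) : ℕ) = 3 := by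
  decide

theorem adjugate_mul_adjugate_two_two (M : Matrix (Fin 4) (Fin 4) D) :
    M.adjugate 2 1 * M.adjugate 0 2 = M.adjugate 2 2 * M.adjugate 0 1 +
      M.det * (M 0 1 * M 3 3 - M 0 3 * M 3 1) := by
  rw [det_eq_row_zero]
  simp only [adjugate_fin_four, succAbove_fin_four, Fin.val_zero, Fin.val_one, Fin.val_two]
  ring

theorem eq_zero_of_col_zero [IsDomain D] {M : Matrix (Fin 4) (Fin 4) D}
    (hc : ∀ a, M a 0 = 0) (h0 : M.adjugate 0 0 = 0) (h01 : M 0 1 = 0) (h02 : M 0 2 = 0)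
    (h03 : M 0 3 = 0) (h12 : M 1 2 = 0) (h13 : M 1 3 = 0) (h21 : M 2 1 = 0) (h23 : M 2 3 = 0)
    (h31 : M 3 1 = 0) (h32 : M 3 2 = 0) (hd1 : M 1 1 = M 2 2) (hd2 : M 2 2 = M 3 3) : M = 0 := by
  simp only [adjugate_fin_four, succAbove_fin_four] at h0
  have h11 : M 3 3 = 0 := by
    simpa [h12, h13, h21, h31, h23, hd1, hd2] using h0
  rw [h11] at hd2
  rw [hd2] at hd1
  ext i j
  fin_cases i <;> fin_cases j <;> simp [*]

theorem eq_zero_of_col_row_minors [IsDomain D] {M : Matrix (Fin 4) (Fin 4) D}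
    (hc : ∀ a b, M a 0 * M b 1 = M b 0 * M a 1) (hr : ∀ a b, M 2 a * M 3 b = M 2 b * M 3 a)
    (h00 : M 0 0 = 0) (h02 : M 0 2 = 0) (h03 : M 0 3 = 0) (h10 : M 1 0 = M 0 1) (h12 : M 1 2 = 0)
    (h13 : M 1 3 = 0) (h20 : M 2 0 = M 1 1) (h30 : M 3 0 = M 2 1) (h31 : M 3 1 = M 2 2)
    (h32 : M 3 2 = M 2 3) (h33 : M 3 3 = 0) : M = 0 := by
  have h01 : M 0 1 = 0 := by simpa [h00, h10] using hc 0 1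
  have h11 : M 1 1 = 0 := by simpa [h01, h10, h20] using hc 1 2
  have h21 : M 2 1 = 0 := by simpa [h11, h20, h30] using hc 2 3
  have h22 : M 2 2 = 0 := by simpa [h21, h31] using hr 1 2
  have h23 : M 2 3 = 0 := by simpa [h22, h32, h33] using hr 2 3
  ext i j
  fin_cases i <;> fin_cases j <;> simp [*]

/-- Row operations bringing the linear section of the rank two locus to triangular form. -/
def rowTransform (D : Type*) [CommRing D] : Matrix (Fin 4) (Fin 4) D :=
  !![-1, 1, 0, 0; 0, 0, -1, 1; 1, 0, 0, 0; 0, 0, 1, 0]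

/-- Column operations bringing the linear section of the rank two locus to triangular form. -/
def colTransform (D : Type*) [CommRing D] : Matrix (Fin 4) (Fin 4) D :=
  !![0, -1, 0, 1; -1, 0, 1, 0; 0, 1, 0, 0; 1, 0, 0, 0]

theorem eq_zero_of_adjugate_eq_zero [IsDomain D] {M T : Matrix (Fin 4) (Fin 4) D}
    (hT : T = rowTransform D * M * colTransform D)
    (hM : M.adjugate = 0) (hq : auxQuartic M = 0) (c : D) (hc0 : c ≠ 0) (hc1 : c ≠ 1)
    (h00 : T 0 0 = 0) (h01 : T 0 1 = 0) (h10 : T 1 0 = 0) (h02 : T 0 2 = T 1 1)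
    (h20 : T 2 0 = T 1 1) (h21 : T 2 1 = T 0 3 + T 1 2) (h30 : T 3 0 = T 0 3 + c * T 1 2)
    (h13 : T 1 3 = T 2 2) (h31 : T 3 1 = T 2 2) (h23 : T 2 3 = T 3 2) (h33 : T 3 3 = 0) :
    M = 0 := by
  have hadj : T.adjugate = 0 := by
    rw [hT, Matrix.adjugate_mul_distrib, Matrix.adjugate_mul_distrib, hM]
    simp
  have h (i j) : T.adjugate i j = 0 := by rw [hadj]; rfl
  simp only [adjugate_fin_four] at h
  have h11 : T 1 1 = 0 := by
    simpa [succAbove_fin_four, h00, h01, h10, h02, h20] using h 3 3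
  have e1 := h 0 3
  have e2 := h 1 2
  have e3 := h 2 1
  have e4 := h 3 0
  simp [succAbove_fin_four, h00, h01, h10, h02, h20, h11, h21, h30] at e1 e2 e3 e4
  have hcw : ∀ v w : D, v = 0 ∨ v + w = 0 → v = 0 ∨ v + c * w = 0 →
      v + w = 0 ∨ v + c * w = 0 → v = 0 ∧ w = 0 := by
    have hc1' : c - 1 ≠ 0 := sub_ne_zero.2 hc1
    intro v w h1 h2 h3
    by_cases hv : v = 0
    · simpa [hv, hc0] using h3
    · have h4 := h1.resolve_left hv
      have h5 := h2.resolve_left hv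
      have hw : w = 0 := (mul_eq_zero.1 (show (c - 1) * w = 0 by linear_combination h5 - h4)
        ).resolve_left hc1'
      exact ⟨by simpa [hw] using h4, hw⟩
  have hvw : T 0 3 = 0 ∧ T 1 2 = 0 := by
    by_cases hw : T 1 2 = 0
    · simpa [hw] using e3
    · simp only [hw, or_false, false_or] at e1 e2 e4
      exact hcw _ _ e1 e2 e4
  obtain ⟨hv, hw⟩ := hvw
  have h22 : T 2 2 = 0 := by
    simpa [succAbove_fin_four, h11, h13, h31, h21, hv, hw, h33] using h 0 0
  have t (i j) : (rowTransform D * M * colTransform D) i j = T i j := by rw [hT]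
  simp [rowTransform, colTransform, Matrix.mul_apply, Matrix.vecMul, dotProduct,
    Fin.sum_univ_four, Fin.forall_fin_succ,
    h00, h01, h10, h02, h20, h11, h21, h30, hv, hw, h13, h31, h22, h23, h33] at t
  obtain ⟨⟨t03, t02, t01, t00⟩, ⟨t13, t12, t11, t10⟩, ⟨t23, t22, t21, t20⟩,
    t33, t32, t31, t30⟩ := t
  have m00 : M 0 0 = T 3 2 := t20
  have m01 : M 0 1 = 0 := t21
  have m02 : M 0 2 = T 3 2 := by linear_combination t22 + t20
  have m03 : M 0 3 = 0 := by linear_combination t23 + t21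
  have m20 : M 2 0 = 0 := t30
  have m21 : M 2 1 = T 3 2 := t31
  have m22 : M 2 2 = 0 := by linear_combination t32 + t30
  have m23 : M 2 3 = T 3 2 := by linear_combination t33 + t31
  have m10 : M 1 0 = T 3 2 := by linear_combination t00 + m00
  have m11 : M 1 1 = 0 := by linear_combination t01 + m01
  have m12 : M 1 2 = T 3 2 := by linear_combination t02 + t00 + m02
  have m13 : M 1 3 = 0 := by linear_combination t03 + t01 + m03
  have m30 : M 3 0 = 0 := by linear_combination t10 + m20
  have m31 : M 3 1 = T 3 2 := by linear_combination t11 + m21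
  have m32 : M 3 2 = 0 := by linear_combination t12 + t10 + m22
  have m33 : M 3 3 = T 3 2 := by linear_combination t13 + t11 + m23
  have hr : T 3 2 = 0 := by
    simpa [auxQuartic, m00, m01, m02, m03, m10, m11, m12, m13, m20, m21, m22, m23, m30, m31, m32,
      m33] using hq
  ext i j
  fin_cases i <;> fin_cases j <;>
    simp [m00, m01, m02, m03, m10, m11, m12, m13, m20, m21, m22, m23, m30, m31, m32, m33, hr]

theorem auxQuartic_mul_det (M : Matrix (Fin 4) (Fin 4) D) :
    auxQuartic M * M.det =
      ((M 1 3 * M 0 0 - M 1 0 * M 0 3) * M.adjugate 3 1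
        - (M 0 0 * M 2 2 - M 0 2 * M 2 0) * M.adjugate 2 2) * M.adjugate 0 0
      + ((M 1 1 * M 3 3 - M 1 3 * M 3 1) * M.adjugate 3 3
        - (M 2 0 * M 1 1 - M 2 1 * M 1 0) * M.adjugate 0 2) * M.adjugate 1 1
      + (M 3 1 * M 2 2 - M 3 2 * M 2 1) * M.adjugate 1 3 * M.adjugate 2 2
      - (M 0 2 * M 3 3 - M 0 3 * M 3 2) * M.adjugate 2 0 * M.adjugate 3 3 := by
  rw [det_eq_row_zero, auxQuartic]
  simp only [adjugate_fin_four, succAbove_fin_four, Fin.val_zero, Fin.val_one, Fin.val_two]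
  ring

theorem exists_perm_fin_four {i j k l : Fin 4} (hij : i ≠ j) (hik : i ≠ k) (hil : i ≠ l)
    (hjk : j ≠ k) (hjl : j ≠ l) (hkl : k ≠ l) :
    ∃ σ : Equiv.Perm (Fin 4), σ 0 = i ∧ σ 1 = j ∧ σ 2 = k ∧ σ 3 = l := by
  have hinj : Function.Injective ![i, j, k, l] := by
    intro a b h
    fin_cases a <;> fin_cases b <;> simp_all
  exact ⟨Equiv.ofBijective _ (Finite.injective_iff_bijective.1 hinj), rfl, rfl, rfl, rfl⟩

theorem adjugate_mul_adjugate_eq_zero {M : Matrix (Fin 4) (Fin 4) D}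
    (hd : ∀ i, M.adjugate i i = 0) (hdet : M.det = 0) {i j : Fin 4} (hij : i ≠ j) (a : Fin 4) :
    M.adjugate a j * M.adjugate i a = 0 := by
  rcases eq_or_ne a i with rfl | hai
  · rw [hd, mul_zero]
  rcases eq_or_ne a j with rfl | haj
  · rw [hd, zero_mul]
  obtain ⟨d, hdi, hdj, hda⟩ : ∃ d : Fin 4, i ≠ d ∧ j ≠ d ∧ a ≠ d := by
    revert i j a
    decide
  obtain ⟨σ, h0, h1, h2, -⟩ := exists_perm_fin_four hij hai.symm hdi haj.symm hdj hda
  have h := adjugate_mul_adjugate_two_two (M.submatrix σ σ)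
  rw [Matrix.adjugate_submatrix_equiv_self, Matrix.det_submatrix_equiv_self, hdet] at h
  simpa [h0, h1, h2, hd] using h

/-- The structure of singular `4 × 4` matrices over a domain with vanishing principal
`3`-minors. -/
theorem singular_cases [IsDomain D] {M : Matrix (Fin 4) (Fin 4) D}
    (hd : ∀ i, M.adjugate i i = 0) (hdet : M.det = 0) :
    M.adjugate = 0 ∨ (∃ i, ∀ a, M a i = 0) ∨ (∃ i, ∀ a, M i a = 0) ∨
      ∃ σ : Equiv.Perm (Fin 4),
        (∀ a b, M a (σ 0) * M b (σ 1) = M b (σ 0) * M a (σ 1)) ∧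
        ∀ a b, M (σ 2) a * M (σ 3) b = M (σ 2) b * M (σ 3) a := by
  by_cases hY : M.adjugate = 0
  · exact Or.inl hY
  right
  obtain ⟨i, j, hY⟩ : ∃ i j, M.adjugate i j ≠ 0 := by
    by_contra! h
    exact hY (Matrix.ext h)
  have hij : i ≠ j := by
    rintro rfl
    exact hY (hd i)
  have hu (a) : ∑ b, M a b * M.adjugate b j = 0 := by
    have h := congrFun (congrFun (Matrix.mul_adjugate M) a) j
    rwa [hdet, zero_smul, Matrix.mul_apply] at h
  have hv (b) : ∑ a, M.adjugate i a * M a b = 0 := by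
    have h := congrFun (congrFun (Matrix.adjugate_mul M) i) b
    rwa [hdet, zero_smul, Matrix.mul_apply] at h
  have huv (a) := adjugate_mul_adjugate_eq_zero hd hdet hij a
  by_cases hk : ∀ k, k ≠ i → M.adjugate k j = 0
  · refine Or.inl ⟨i, fun a => ?_⟩
    have h := hu a
    rw [Finset.sum_eq_single i (fun b _ hb => by rw [hk b hb, mul_zero]) (by simp)] at h
    exact (mul_eq_zero.1 h).resolve_right hY
  right
  by_cases hl : ∀ l, l ≠ j → M.adjugate i l = 0
  · refine Or.inl ⟨j, fun a => ?_⟩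
    have h := hv a
    rw [Finset.sum_eq_single j (fun b _ hb => by rw [hl b hb, zero_mul]) (by simp)] at h
    exact (mul_eq_zero.1 h).resolve_left hY
  right
  push Not at hk hl
  obtain ⟨k, hki, hk⟩ := hk
  obtain ⟨l, hlj, hl⟩ := hl
  have hvk : M.adjugate i k = 0 := (mul_eq_zero.1 (huv k)).resolve_left hk
  have hul : M.adjugate l j = 0 := (mul_eq_zero.1 (huv l)).resolve_right hl
  obtain ⟨σ, h0, h1, h2, h3⟩ := exists_perm_fin_four (i := i) (j := k) (k := j) (l := l)
    hki.symm hij (by rintro rfl; exact hl (hd i)) (by rintro rfl; exact hk (hd k))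
    (by rintro rfl; exact hl hvk) hlj.symm
  refine ⟨σ, fun a b => ?_, fun a b => ?_⟩
  · have key (a) : M a i * M.adjugate i j + M a k * M.adjugate k j = 0 := by
      have h := hu a
      rw [← Equiv.sum_comp σ, Fin.sum_univ_four, h0, h1, h2, h3, hd, hul] at h
      simpa using h
    rw [h0, h1]
    refine mul_right_cancel₀ hY ?_
    linear_combination M b k * key a - M a k * key b
  · have key (b) : M.adjugate i j * M j b + M.adjugate i l * M l b = 0 := by
      have h := hv b
      rw [← Equiv.sum_comp σ, Fin.sum_univ_four, h0, h1, h2, h3, hd, hvk] at h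
      simpa using h
    rw [h2, h3]
    refine mul_right_cancel₀ hY ?_
    linear_combination M l b * key a - M l a * key b

end DeterminantalCases

section DimensionBound

open IsLocalRing

variable {R : Type*} [CommRing R]

theorem entry_mem_of_map_eq_zero {x : Matrix (Fin 4) (Fin 4) R} {q : Ideal R}
    (h : x.map (Ideal.Quotient.mk q) = 0) (i j : Fin 4) : x i j ∈ q :=
  Ideal.Quotient.eq_zero_iff_mem.1 (congrFun (congrFun h i) j)

theorem adjugate_map_mk (x : Matrix (Fin 4) (Fin 4) R) (q : Ideal R) (i j : Fin 4) :
    (x.map (Ideal.Quotient.mk q)).adjugate i j = Ideal.Quotient.mk q (x.adjugate i j) := by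
  rw [← RingHom.mapMatrix_apply, ← RingHom.map_adjugate]
  rfl

theorem auxQuartic_map {D E : Type*} [CommRing D] [CommRing E] (f : D →+* E)
    (M : Matrix (Fin 4) (Fin 4) D) : auxQuartic (M.map f) = f (auxQuartic M) := by
  simp [auxQuartic]

theorem transform_map {D E : Type*} [CommRing D] [CommRing E] (f : D →+* E)
    (M : Matrix (Fin 4) (Fin 4) D) :
    (rowTransform D * M * colTransform D).map f =
      rowTransform E * M.map f * colTransform E := by
  have hrow : (rowTransform D).map f = rowTransform E := by
    ext i j
    fin_cases i <;> fin_cases j <;> simp [rowTransform]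
  have hcol : (colTransform D).map f = colTransform E := by
    ext i j
    fin_cases i <;> fin_cases j <;> simp [colTransform]
  rw [Matrix.map_mul, Matrix.map_mul, hrow, hcol]

variable [IsLocalRing R]

theorem dimLE_of_col_zero {x : Matrix (Fin 4) (Fin 4) R} {p : Ideal R}
    (hx : ∀ i j, x i j ∈ maximalIdeal R)
    (hgen : ∀ q : Ideal R, (∀ i j, x i j ∈ q) → maximalIdeal R ≤ q)
    (hc : ∀ a, x a 0 ∈ p) (h0 : x.adjugate 0 0 ∈ p) : DimLE 11 p := by
  refine DimLE.of_list [x 0 1, x 0 2, x 0 3, x 1 2, x 1 3, x 2 1, x 2 3, x 3 1, x 3 2,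
    x 1 1 - x 2 2, x 2 2 - x 3 3] ?_ ?_
  · simp only [List.forall_mem_cons]
    simp [hx, Ideal.sub_mem]
  · intro q hq hle hL
    simp only [List.forall_mem_cons] at hL
    obtain ⟨h01, h02, h03, h12, h13, h21, h23, h31, h32, hd1, hd2, -⟩ := hL
    rw [← Ideal.Quotient.eq] at hd1 hd2
    refine hgen q (entry_mem_of_map_eq_zero (eq_zero_of_col_zero
      (fun a => Ideal.Quotient.eq_zero_iff_mem.2 (hle (hc a)))
      (by rw [adjugate_map_mk]; exact Ideal.Quotient.eq_zero_iff_mem.2 (hle h0))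
      ?_ ?_ ?_ ?_ ?_ ?_ ?_ ?_ ?_ hd1 hd2)) <;>
    exact Ideal.Quotient.eq_zero_iff_mem.2 (by assumption)

theorem dimLE_of_col_row_minors {x : Matrix (Fin 4) (Fin 4) R} {p : Ideal R}
    (hx : ∀ i j, x i j ∈ maximalIdeal R)
    (hgen : ∀ q : Ideal R, (∀ i j, x i j ∈ q) → maximalIdeal R ≤ q)
    (hc : ∀ a b, x a 0 * x b 1 - x b 0 * x a 1 ∈ p)
    (hr : ∀ a b, x 2 a * x 3 b - x 2 b * x 3 a ∈ p) : DimLE 11 p := by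
  refine DimLE.of_list [x 0 0, x 0 2, x 0 3, x 1 0 - x 0 1, x 1 2, x 1 3, x 2 0 - x 1 1,
    x 3 0 - x 2 1, x 3 1 - x 2 2, x 3 2 - x 2 3, x 3 3] ?_ ?_
  · simp only [List.forall_mem_cons]
    simp [hx, Ideal.sub_mem]
  · intro q hq hle hL
    simp only [List.forall_mem_cons, ← Ideal.Quotient.eq] at hL
    obtain ⟨h00, h02, h03, h10, h12, h13, h20, h30, h31, h32, h33, -⟩ := hL
    have hc' (a b) := Ideal.Quotient.eq.2 (hle (hc a b))
    have hr' (a b) := Ideal.Quotient.eq.2 (hle (hr a b))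
    simp only [map_mul] at hc' hr'
    refine hgen q (entry_mem_of_map_eq_zero (eq_zero_of_col_row_minors hc' hr'
      ?_ ?_ ?_ h10 ?_ ?_ h20 h30 h31 h32 ?_)) <;>
    exact Ideal.Quotient.eq_zero_iff_mem.2 (by assumption)

theorem dimLE_of_adjugate (K : Type*) [Field K] [Infinite K] [Algebra K R]
    {x : Matrix (Fin 4) (Fin 4) R} {p : Ideal R}
    (hx : ∀ i j, x i j ∈ maximalIdeal R)
    (hgen : ∀ q : Ideal R, (∀ i j, x i j ∈ q) → maximalIdeal R ≤ q)
    (hadj : ∀ i j, x.adjugate i j ∈ p) (hq : auxQuartic x ∈ p) : DimLE 11 p := by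
  classical
  obtain ⟨c, hc⟩ := Infinite.exists_notMem_finset ({0, 1} : Finset K)
  simp only [Finset.mem_insert, Finset.mem_singleton, not_or] at hc
  obtain ⟨hc0, hc1⟩ := hc
  obtain ⟨T, hT⟩ : ∃ T, T = rowTransform R * x * colTransform R := ⟨_, rfl⟩
  have hTm (i j) : T i j ∈ maximalIdeal R := by
    rw [hT, Matrix.mul_apply]
    refine Ideal.sum_mem _ fun k _ => Ideal.mul_mem_right _ _ ?_
    rw [Matrix.mul_apply]
    exact Ideal.sum_mem _ fun k _ => Ideal.mul_mem_left _ _ (hx _ _)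
  refine DimLE.of_list [T 0 0, T 0 1, T 1 0, T 0 2 - T 1 1, T 2 0 - T 1 1,
    T 2 1 - (T 0 3 + T 1 2), T 3 0 - (T 0 3 + algebraMap K R c * T 1 2), T 1 3 - T 2 2,
    T 3 1 - T 2 2, T 2 3 - T 3 2, T 3 3] ?_ ?_
  · simp only [List.forall_mem_cons]
    have hlin : T 3 0 - (T 0 3 + algebraMap K R c * T 1 2) ∈ maximalIdeal R :=
      Ideal.sub_mem _ (hTm _ _) (Ideal.add_mem _ (hTm _ _) (Ideal.mul_mem_left _ _ (hTm _ _)))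
    simp only [hTm, hlin, Ideal.sub_mem, Ideal.add_mem, true_and, List.not_mem_nil,
      false_imp_iff, implies_true]
  · intro q hprime hle hL
    simp only [List.forall_mem_cons, ← Ideal.Quotient.eq, map_add, map_mul] at hL
    obtain ⟨h00, h01, h10, h02, h20, h21, h30, h13, h31, h23, h33, -⟩ := hL
    have hcq (a : K) (ha : a ≠ 0) :
        Ideal.Quotient.mk q (algebraMap K R a) ≠ 0 := by
      rw [Ne, ← RingHom.comp_apply, map_eq_zero]
      exact ha
    refine hgen q (entry_mem_of_map_eq_zero (eq_zero_of_adjugate_eq_zero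
      (T := T.map (Ideal.Quotient.mk q)) (by rw [hT, transform_map]) ?_ ?_
      (Ideal.Quotient.mk q (algebraMap K R c)) (hcq c hc0) ?_
      ?_ ?_ ?_ h02 h20 h21 h30 h13 h31 h23 ?_))
    · ext i j
      rw [adjugate_map_mk]
      exact Ideal.Quotient.eq_zero_iff_mem.2 (hle (hadj i j))
    · rw [auxQuartic_map]
      exact Ideal.Quotient.eq_zero_iff_mem.2 (hle hq)
    · have h := hcq (c - 1) (sub_ne_zero.2 hc1)
      rwa [map_sub, map_sub, map_one, map_one, sub_ne_zero] at h
    all_goals exact Ideal.Quotient.eq_zero_iff_mem.2 (by assumption)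

theorem dimLE_of_adjugate_diag_mem (K : Type*) [Field K] [Infinite K] [Algebra K R]
    {x : Matrix (Fin 4) (Fin 4) R} {p : Ideal R} [p.IsPrime]
    (hx : ∀ i j, x i j ∈ maximalIdeal R)
    (hgen : ∀ q : Ideal R, (∀ i j, x i j ∈ q) → maximalIdeal R ≤ q)
    (hd : ∀ i, x.adjugate i i ∈ p) (hs : x.det + auxQuartic x ∈ p) : DimLE 11 p := by
  have hprod : auxQuartic x * x.det ∈ p := by
    rw [auxQuartic_mul_det]
    exact p.sub_mem (p.add_mem (p.add_mem (p.mul_mem_left _ (hd _)) (p.mul_mem_left _ (hd _)))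
      (p.mul_mem_left _ (hd _))) (p.mul_mem_left _ (hd _))
  have hdc : x.det ∈ p ∧ auxQuartic x ∈ p := by
    rcases Ideal.IsPrime.mem_or_mem ‹_› hprod with h | h
    · exact ⟨by simpa using p.sub_mem hs h, h⟩
    · exact ⟨h, by simpa using p.sub_mem hs h⟩
  obtain ⟨hdet, haux⟩ := hdc
  have hd' (i) : (x.map (Ideal.Quotient.mk p)).adjugate i i = 0 := by
    rw [adjugate_map_mk]
    exact Ideal.Quotient.eq_zero_iff_mem.2 (hd i)
  have hdet' : (x.map (Ideal.Quotient.mk p)).det = 0 := by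
    rw [← RingHom.mapMatrix_apply, ← RingHom.map_det]
    exact Ideal.Quotient.eq_zero_iff_mem.2 hdet
  rcases singular_cases hd' hdet' with h | ⟨i, h⟩ | ⟨i, h⟩ | ⟨σ, hc, hr⟩
  · refine dimLE_of_adjugate K hx hgen (fun i j => ?_) haux
    rw [← Ideal.Quotient.eq_zero_iff_mem, ← adjugate_map_mk, h]
    rfl
  · refine dimLE_of_col_zero (x := x.submatrix (Equiv.swap 0 i) (Equiv.swap 0 i))
      (fun _ _ => hx _ _) (fun q hq => hgen q fun a b => ?_) (fun a => ?_) ?_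
    · simpa using hq (Equiv.swap 0 i a) (Equiv.swap 0 i b)
    · simpa using Ideal.Quotient.eq_zero_iff_mem.1 (h (Equiv.swap 0 i a))
    · rw [Matrix.adjugate_submatrix_equiv_self]
      exact hd _
  · refine dimLE_of_col_zero (x := xᵀ.submatrix (Equiv.swap 0 i) (Equiv.swap 0 i))
      (fun _ _ => hx _ _) (fun q hq => hgen q fun a b => ?_) (fun a => ?_) ?_
    · simpa using hq (Equiv.swap 0 i b) (Equiv.swap 0 i a)
    · simpa using Ideal.Quotient.eq_zero_iff_mem.1 (h (Equiv.swap 0 i a))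
    · rw [Matrix.adjugate_submatrix_equiv_self, ← Matrix.adjugate_transpose]
      exact hd _
  · refine dimLE_of_col_row_minors (x := x.submatrix σ σ)
      (fun _ _ => hx _ _) (fun q hq => hgen q fun a b => ?_) (fun a b => ?_) (fun a b => ?_)
    · simpa using hq (σ.symm a) (σ.symm b)
    · rw [← Ideal.Quotient.eq, map_mul, map_mul]
      exact hc (σ a) (σ b)
    · rw [← Ideal.Quotient.eq, map_mul, map_mul]
      exact hr (σ a) (σ b)

end DimensionBound

section GenericMatrix

attribute [local instance] MvPolynomial.gradedAlgebra

theorem isHomogeneous_det {σ K n : Type*} [Field K] [Fintype n] [DecidableEq n]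
    {M : Matrix n n (MvPolynomial σ K)} (h : ∀ i j, (M i j).IsHomogeneous 1) :
    M.det.IsHomogeneous (Fintype.card n) := by
  rw [Matrix.det_apply]
  refine MvPolynomial.IsHomogeneous.sum _ _ _ fun τ _ => ?_
  have hp : (∏ i, M (τ i) i).IsHomogeneous (Fintype.card n) := by
    simpa using MvPolynomial.IsHomogeneous.prod Finset.univ (fun i => M (τ i) i) (fun _ => 1)
      fun i _ => h _ _
  rw [Units.smul_def, zsmul_eq_mul, ← map_intCast (MvPolynomial.C : K →+* MvPolynomial σ K)]
  exact hp.C_mul _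

theorem mem_of_mul_mem_of_isHomogeneous {σ K : Type*} [Field K] {I : Ideal (MvPolynomial σ K)}
    (hI : I.IsHomogeneous (MvPolynomial.homogeneousSubmodule σ K)) {u h : MvPolynomial σ K} {d : ℕ}
    (hu : MvPolynomial.constantCoeff u ≠ 0) (hh : h.IsHomogeneous d) (huh : u * h ∈ I) :
    h ∈ I := by
  have h1 := hI (0 + d) huh
  rw [DirectSum.coe_decompose_mul_add_of_right_mem _
    ((MvPolynomial.mem_homogeneousSubmodule d h).2 hh)] at h1
  have h2 : ((DirectSum.decompose (MvPolynomial.homogeneousSubmodule σ K) u 0 :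
      MvPolynomial.homogeneousSubmodule σ K 0) : MvPolynomial σ K) =
      MvPolynomial.C (MvPolynomial.constantCoeff u) := by
    rw [MvPolynomial.constantCoeff_eq, ← MvPolynomial.homogeneousComponent_zero]
    exact MvPolynomial.decomposition.decompose'_apply u 0
  rw [h2] at h1
  have h3 := I.mul_mem_left (MvPolynomial.C (MvPolynomial.constantCoeff u)⁻¹) h1
  rwa [← mul_assoc, ← map_mul, inv_mul_cancel₀ hu, map_one, one_mul] at h3

variable (K : Type*) [Field K]

theorem isHomogeneous_prinMinorIdeal (n t : ℕ) :
    (prinMinorIdeal K n t).IsHomogeneous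
      (MvPolynomial.homogeneousSubmodule (Fin n × Fin n) K) := by
  refine Ideal.homogeneous_span _ _ ?_
  rintro _ ⟨s, -, rfl⟩
  exact ⟨_, (MvPolynomial.mem_homogeneousSubmodule _ _).2
    (isHomogeneous_det fun _ _ => MvPolynomial.isHomogeneous_X _ _)⟩

theorem adjugate_diag_eq_det_submatrix {D : Type*} [CommRing D] {n : ℕ}
    (M : Matrix (Fin (n + 1)) (Fin (n + 1)) D) (i : Fin (n + 1)) {s : Finset (Fin (n + 1))}
    (hs : ∀ j, j ≠ i ↔ j ∈ s) :
    M.adjugate i i = (M.submatrix (fun j : {x // x ∈ s} => (j : Fin (n + 1)))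
      (fun j : {x // x ∈ s} => (j : Fin (n + 1)))).det := by
  rw [adjugate_fin_succ_eq_det_submatrix, Even.neg_one_pow ⟨_, rfl⟩, one_mul,
    ← det_submatrix_equiv_self ((finSuccAboveEquiv i).trans (Equiv.subtypeEquivRight hs))]
  rfl

theorem prinMinorIdeal_four_three :
    prinMinorIdeal K 4 3 = Ideal.span (Set.range fun i => (genMat K 4).adjugate i i) := by
  refine congrArg Ideal.span (Set.ext fun p => ⟨?_, ?_⟩)
  · rintro ⟨s, hs, rfl⟩
    have hc : sᶜ.card = 1 := by rw [Finset.card_compl, hs, Fintype.card_fin]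
    obtain ⟨i, hi⟩ := Finset.card_eq_one.1 hc
    refine ⟨i, adjugate_diag_eq_det_submatrix _ _ fun j => ?_⟩
    rw [← not_iff_not, not_not, ← Finset.mem_compl, hi, Finset.mem_singleton]
  · rintro ⟨i, rfl⟩
    refine ⟨{i}ᶜ, ?_, adjugate_diag_eq_det_submatrix _ _ fun j => by simp⟩
    rw [Finset.card_compl, Finset.card_singleton, Fintype.card_fin]

theorem adjugate_mem_prinMinorIdeal (i : Fin 4) :
    (genMat K 4).adjugate i i ∈ prinMinorIdeal K 4 3 := by
  rw [prinMinorIdeal_four_three]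
  exact Ideal.subset_span ⟨i, rfl⟩

theorem auxQuartic_mul_det_mem : auxQuartic (genMat K 4) * (genMat K 4).det ∈
    prinMinorIdeal K 4 3 := by
  have h := adjugate_mem_prinMinorIdeal K
  rw [auxQuartic_mul_det]
  exact sub_mem (add_mem (add_mem (Ideal.mul_mem_left _ _ (h _)) (Ideal.mul_mem_left _ _ (h _)))
    (Ideal.mul_mem_left _ _ (h _))) (Ideal.mul_mem_left _ _ (h _))

theorem regularMod_det_add_auxQuartic [Infinite K] :
    RegularMod ((prinMinorIdeal K 4 3).map
        (algebraMap _ (OriginRing (Fin 4 × Fin 4) K)))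
      (algebraMap _ (OriginRing (Fin 4 × Fin 4) K)
        ((genMat K 4).det + auxQuartic (genMat K 4))) := by
  let φ := algebraMap (MvPolynomial (Fin 4 × Fin 4) K) (OriginRing (Fin 4 × Fin 4) K)
  let x := (genMat K 4).map φ
  have hadj (i : Fin 4) : φ ((genMat K 4).adjugate i i) = x.adjugate i i := by
    have := RingHom.map_adjugate φ (genMat K 4)
    exact congrFun (congrFun this i) i
  have hs : φ ((genMat K 4).det + auxQuartic (genMat K 4)) = x.det + auxQuartic x := by
    rw [map_add, auxQuartic_map, RingHom.map_det, RingHom.mapMatrix_apply]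
  have hzero : (genMat K 4).map (MvPolynomial.constantCoeff (R := K)) = 0 := by
    ext i j
    exact MvPolynomial.constantCoeff_X _ _
  have hx (i j) : x i j ∈ IsLocalRing.maximalIdeal _ :=
    algebraMap_mem_maximalIdeal (RingHom.mem_ker.2 (MvPolynomial.constantCoeff_X _ _))
  have hgen (q : Ideal (OriginRing (Fin 4 × Fin 4) K)) (hq : ∀ i j, x i j ∈ q) :
      IsLocalRing.maximalIdeal _ ≤ q := by
    rw [maximalIdeal_originRing, Ideal.span_le]
    rintro _ ⟨⟨i, j⟩, -, rfl⟩
    exact hq i j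
  have hadjm (i : Fin 4) : x.adjugate i i ∈ IsLocalRing.maximalIdeal _ := by
    rw [← hadj]
    refine algebraMap_mem_maximalIdeal (RingHom.mem_ker.2 ?_)
    have := RingHom.map_adjugate (MvPolynomial.constantCoeff (R := K)) (genMat K 4)
    rw [RingHom.mapMatrix_apply, RingHom.mapMatrix_apply, hzero, adjugate_zero] at this
    exact congrFun (congrFun this i) i
  have hsm : x.det + auxQuartic x ∈ IsLocalRing.maximalIdeal _ := by
    rw [← hs]
    refine algebraMap_mem_maximalIdeal (RingHom.mem_ker.2 ?_)
    rw [map_add, RingHom.map_det, RingHom.mapMatrix_apply, ← auxQuartic_map, hzero]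
    simp [auxQuartic, det_zero]
  have key := HasDepth.regularSeqMod K (m := 11) (I := (⊥ : Ideal (OriginRing (Fin 4 × Fin 4) K)))
    [x.adjugate 3 3, x.adjugate 2 2, x.adjugate 1 1, x.adjugate 0 0, x.det + auxQuartic x]
    (by simpa using hasDepth_originRing (σ := Fin 4 × Fin 4) (K := K))
    (by simp only [List.forall_mem_cons, hadjm, hsm, true_and, List.not_mem_nil,
      false_imp_iff, implies_true]) (DimLE.of_forall_isPrime fun p hp hle => by
      have hmem : ∀ f ∈ [x.adjugate 3 3, x.adjugate 2 2, x.adjugate 1 1, x.adjugate 0 0,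
          x.det + auxQuartic x], f ∈ p := fun f hf =>
        (le_sup_right.trans hle) (Ideal.subset_span hf)
      simp only [List.forall_mem_cons] at hmem
      obtain ⟨h0, h1, h2, h3, h4, -⟩ := hmem
      refine dimLE_of_adjugate_diag_mem K hx hgen (fun i => ?_) h4
      fin_cases i <;> assumption)
  obtain ⟨-, -, -, -, h, -⟩ := key
  have hP : (prinMinorIdeal K 4 3).map φ = (((⊥ ⊔ Ideal.span {x.adjugate 3 3}) ⊔
      Ideal.span {x.adjugate 2 2}) ⊔ Ideal.span {x.adjugate 1 1}) ⊔
      Ideal.span {x.adjugate 0 0} := by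
    rw [prinMinorIdeal_four_three, Ideal.map_span, bot_sup_eq, ← Ideal.span_union,
      ← Ideal.span_union, ← Ideal.span_union, ← Set.range_comp]
    congr 1
    ext y
    simp [Fin.exists_fin_succ, hadj, eq_comm]
  change RegularMod (Ideal.map φ _) (φ _)
  rw [hs, hP]
  exact h

variable {K}

theorem mul_det_mem_of_mul_det_sq_mem [Infinite K] {g : MvPolynomial (Fin 4 × Fin 4) K}
    (hg : g * (genMat K 4).det ^ 2 ∈ prinMinorIdeal K 4 3) :
    g * (genMat K 4).det ∈ prinMinorIdeal K 4 3 := by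
  have hI := isHomogeneous_prinMinorIdeal K 4 3
  have hdet : (genMat K 4).det.IsHomogeneous 4 :=
    isHomogeneous_det fun _ _ => MvPolynomial.isHomogeneous_X _ _
  have hcomp (d : ℕ) : MvPolynomial.homogeneousComponent d g * (genMat K 4).det ∈
      prinMinorIdeal K 4 3 := by
    have h1 := hI (d + 4 * 2) hg
    rw [DirectSum.coe_decompose_mul_add_of_right_mem _
      ((MvPolynomial.mem_homogeneousSubmodule _ _).2 (hdet.pow 2))] at h1
    have h2 : ((DirectSum.decompose (MvPolynomial.homogeneousSubmodule (Fin 4 × Fin 4) K) g d :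
        MvPolynomial.homogeneousSubmodule (Fin 4 × Fin 4) K d) : MvPolynomial _ K) =
        MvPolynomial.homogeneousComponent d g :=
      MvPolynomial.decomposition.decompose'_apply g d
    rw [h2] at h1
    obtain ⟨u, hu, huh⟩ := exists_notMem_mul_mem_of_regularMod
      (originIdeal (Fin 4 × Fin 4) K).primeCompl (regularMod_det_add_auxQuartic K)
      (h := MvPolynomial.homogeneousComponent d g * (genMat K 4).det) (by
        convert add_mem h1 (Ideal.mul_mem_left _ (MvPolynomial.homogeneousComponent d g)
          (auxQuartic_mul_det_mem K)) using 1
        ring)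
    exact mem_of_mul_mem_of_isHomogeneous hI (fun h => hu (RingHom.mem_ker.2 h))
      ((MvPolynomial.homogeneousComponent_isHomogeneous d g).mul hdet) huh
  rw [← MvPolynomial.sum_homogeneousComponent g, Finset.sum_mul]
  exact Ideal.sum_mem _ fun d _ => hcomp d

theorem mul_det_mem_of_mul_det_pow_mem [Infinite K] {g : MvPolynomial (Fin 4 × Fin 4) K} {n : ℕ}
    (hg : g * (genMat K 4).det ^ n ∈ prinMinorIdeal K 4 3) :
    g * (genMat K 4).det ∈ prinMinorIdeal K 4 3 := by
  induction n with
  | zero => exact Ideal.mul_mem_right _ _ (by simpa using hg)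
  | succ n ih =>
    cases n with
    | zero => simpa using hg
    | succ n =>
      refine ih ?_
      rw [pow_succ, ← mul_assoc]
      refine mul_det_mem_of_mul_det_sq_mem ?_
      convert hg using 1
      ring

end GenericMatrix

/-- For `n = 4`, `Q₃ = P₃ : Δ`, the colon of `P₃` by the single element
`Δ = det X`. -/
theorem Qideal_eq_colon_det (K : Type*) [Field K] [IsAlgClosed K] :
    Qideal K 4 =
      Submodule.colon (prinMinorIdeal K 4 3) (Ideal.span {(genMat K 4).det}) := by
  ext g
  rw [Ideal.mem_colon_span_singleton, Qideal, Ideal.mem_comap,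
    IsLocalization.algebraMap_mem_map_algebraMap_iff (Submonoid.powers (genMat K 4).det)]
  constructor
  · rintro ⟨_, ⟨n, rfl⟩, h⟩
    rw [mul_comm] at h
    exact mul_det_mem_of_mul_det_pow_mem h
  · intro h
    exact ⟨_, Submonoid.mem_powers _, by rwa [mul_comm] at h⟩
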